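/- For every dimension d ≥ 1, every bandwidth σ > 0, every finite collection of location points η_1, …, η_M ∈ ℝ^d and every weight vector w ∈ ℝ^M, the inequality ∑_{a=1}^M ∑_{b=1}^M w_a w_b k_{√2·σ}(η_a, η_b) ≤ ∑_{a=1}^M ∑_{b=1}^M w_a w_b k_σ(η_a, η_b) holds; equivalently, the squared RKHS norm of f = ∑_a w_a k_{√2·σ}(·, η_a) in the RKHS of k_{√2·σ} is bounded above by the squared RKHS norm of g = ∑_a w_a k_σ(·, η_a) in the RKHS of k_σ (Theorem 3.1). -/

import Mathlib

open scoped BigOperators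

/-- The Gaussian density kernel on `ℝ^d` with bandwidth `σ`:
`k_σ(y, y') = (2πσ²)^(-d/2) · exp(−‖y − y'‖² / (2σ²))`. -/
noncomputable def gaussKernel (d : ℕ) (σ : ℝ) (y y' : EuclideanSpace ℝ (Fin d)) : ℝ :=
  (2 * Real.pi * σ ^ 2) ^ (-(d : ℝ) / 2) * Real.exp (-‖y - y'‖ ^ 2 / (2 * σ ^ 2))

open MeasureTheory

/-- The damped cosine `exp (-b‖v‖²) cos ⟪x, v⟫` is the real part of a complex Gaussian. -/
lemma exp_mul_cos_inner_eq_re {V : Type*} [NormedAddCommGroup V] [InnerProductSpace ℝ V]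
    (b : ℝ) (x v : V) :
    Real.exp (-b * ‖v‖ ^ 2) * Real.cos (inner ℝ x v) =
      RCLike.re (Complex.exp (-(b : ℂ) * ‖v‖ ^ 2 + Complex.I * inner ℝ x v)) := by
  simp [Complex.exp_re, pow_two]

section

variable {V : Type*} [NormedAddCommGroup V] [InnerProductSpace ℝ V] [FiniteDimensional ℝ V]
  [MeasurableSpace V] [BorelSpace V]

lemma integrable_exp_mul_cos_inner {b : ℝ} (hb : 0 < b) (x : V) :
    Integrable fun v : V => Real.exp (-b * ‖v‖ ^ 2) * Real.cos (inner ℝ x v) := by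
  simp_rw [exp_mul_cos_inner_eq_re]
  exact (GaussianFourier.integrable_cexp_neg_mul_sq_norm_add (b := (b : ℂ)) (by simpa)
    Complex.I x).re

lemma integral_exp_mul_cos_inner {b : ℝ} (hb : 0 < b) (x : V) :
    ∫ v : V, Real.exp (-b * ‖v‖ ^ 2) * Real.cos (inner ℝ x v) =
      (Real.pi / b) ^ ((Module.finrank ℝ V : ℝ) / 2) * Real.exp (-‖x‖ ^ 2 / (4 * b)) := by
  simp_rw [exp_mul_cos_inner_eq_re]
  rw [integral_re (GaussianFourier.integrable_cexp_neg_mul_sq_norm_add (b := (b : ℂ)) (by simpa)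
    Complex.I x), GaussianFourier.integral_cexp_neg_mul_sq_norm_add (b := (b : ℂ)) (by simpa)]
  have h : ((Real.pi : ℂ) / b) ^ ((Module.finrank ℝ V : ℂ) / 2) *
      Complex.exp (Complex.I ^ 2 * ‖x‖ ^ 2 / (4 * b)) =
      (((Real.pi / b) ^ ((Module.finrank ℝ V : ℝ) / 2) *
        Real.exp (-‖x‖ ^ 2 / (4 * b)) : ℝ) : ℂ) := by
    rw [Complex.ofReal_mul, Complex.ofReal_cpow (by positivity)]
    simp
  rw [h]
  exact Complex.ofReal_re _

end

lemma gaussKernel_eq_integral (d : ℕ) {σ : ℝ} (hσ : 0 < σ) (y y' : EuclideanSpace ℝ (Fin d)) :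
    gaussKernel d σ y y' = (4 * Real.pi ^ 2) ^ (-(d : ℝ) / 2) *
      ∫ v : EuclideanSpace ℝ (Fin d),
        Real.exp (-(σ ^ 2 / 2) * ‖v‖ ^ 2) * Real.cos (inner ℝ (y - y') v) := by
  have hπ := Real.pi_pos
  rw [integral_exp_mul_cos_inner (by positivity), gaussKernel, finrank_euclideanSpace_fin,
    ← mul_assoc]
  congr 1
  · rw [show Real.pi / (σ ^ 2 / 2) = (4 * Real.pi ^ 2) / (2 * Real.pi * σ ^ 2) by field_simp; ring,
      Real.div_rpow (by positivity) (by positivity), neg_div, Real.rpow_neg (by positivity),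
      Real.rpow_neg (by positivity)]
    have h : (4 * Real.pi ^ 2) ^ ((d : ℝ) / 2) ≠ 0 := by positivity
    field_simp
  · congr 2
    ring

/-- The trigonometric quadratic form is the squared modulus of an exponential sum. -/
lemma sum_sum_mul_cos_sub {ι : Type*} [Fintype ι] (w θ : ι → ℝ) :
    ∑ a, ∑ b, w a * w b * Real.cos (θ a - θ b) =
      (∑ a, w a * Real.cos (θ a)) ^ 2 + (∑ a, w a * Real.sin (θ a)) ^ 2 := by
  simp_rw [pow_two, Finset.sum_mul_sum, ← Finset.sum_add_distrib, Real.cos_sub]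
  exact Finset.sum_congr rfl fun a _ => Finset.sum_congr rfl fun b _ => by ring

section

variable {d M : ℕ} (η : Fin M → EuclideanSpace ℝ (Fin d)) (w : Fin M → ℝ)

lemma exp_mul_sum_sq_eq (c : ℝ) (v : EuclideanSpace ℝ (Fin d)) :
    Real.exp (-c * ‖v‖ ^ 2) * ((∑ a, w a * Real.cos (inner ℝ (η a) v)) ^ 2 +
        (∑ a, w a * Real.sin (inner ℝ (η a) v)) ^ 2) =
      ∑ a, ∑ b, w a * w b *
        (Real.exp (-c * ‖v‖ ^ 2) * Real.cos (inner ℝ (η a - η b) v)) := by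
  simp_rw [← sum_sum_mul_cos_sub, Finset.mul_sum, inner_sub_left]
  exact Finset.sum_congr rfl fun a _ => Finset.sum_congr rfl fun b _ => by ring

lemma integrable_exp_mul_sum_sq {c : ℝ} (hc : 0 < c) :
    Integrable fun v : EuclideanSpace ℝ (Fin d) =>
      Real.exp (-c * ‖v‖ ^ 2) * ((∑ a, w a * Real.cos (inner ℝ (η a) v)) ^ 2 +
        (∑ a, w a * Real.sin (inner ℝ (η a) v)) ^ 2) := by
  simp_rw [exp_mul_sum_sq_eq]
  exact integrable_finsetSum _ fun a _ => integrable_finsetSum _ fun b _ =>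
    (integrable_exp_mul_cos_inner hc _).const_mul _

lemma sum_sum_gaussKernel_eq_integral {σ : ℝ} (hσ : 0 < σ) :
    ∑ a, ∑ b, w a * w b * gaussKernel d σ (η a) (η b) =
      (4 * Real.pi ^ 2) ^ (-(d : ℝ) / 2) * ∫ v : EuclideanSpace ℝ (Fin d),
        Real.exp (-(σ ^ 2 / 2) * ‖v‖ ^ 2) * ((∑ a, w a * Real.cos (inner ℝ (η a) v)) ^ 2 +
          (∑ a, w a * Real.sin (inner ℝ (η a) v)) ^ 2) := by
  have hc : 0 < σ ^ 2 / 2 := by positivity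
  simp_rw [exp_mul_sum_sq_eq]
  rw [integral_finsetSum _ fun a _ => integrable_finsetSum _ fun b _ =>
    (integrable_exp_mul_cos_inner hc _).const_mul _, Finset.mul_sum]
  refine Finset.sum_congr rfl fun a _ => ?_
  rw [integral_finsetSum _ fun b _ => (integrable_exp_mul_cos_inner hc _).const_mul _,
    Finset.mul_sum]
  refine Finset.sum_congr rfl fun b _ => ?_
  rw [integral_const_mul, gaussKernel_eq_integral d hσ]
  ring

end

/-- Quadratic forms of the Gaussian density kernel decrease as the bandwidth grows. -/
lemma sum_sum_gaussKernel_le {d M : ℕ} {σ τ : ℝ} (hσ : 0 < σ) (hστ : σ ≤ τ)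
    (η : Fin M → EuclideanSpace ℝ (Fin d)) (w : Fin M → ℝ) :
    ∑ a, ∑ b, w a * w b * gaussKernel d τ (η a) (η b) ≤
      ∑ a, ∑ b, w a * w b * gaussKernel d σ (η a) (η b) := by
  have hτ : 0 < τ := hσ.trans_le hστ
  rw [sum_sum_gaussKernel_eq_integral η w hσ, sum_sum_gaussKernel_eq_integral η w hτ]
  refine mul_le_mul_of_nonneg_left (integral_mono
    (integrable_exp_mul_sum_sq η w (by positivity))
    (integrable_exp_mul_sum_sq η w (by positivity)) fun v => ?_) (by positivity)
  dsimp only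
  gcongr

/-- Theorem 3.1: the quadratic form of the Gaussian density kernel with bandwidth `√2·σ`
is bounded above by the quadratic form with bandwidth `σ`, i.e.
`‖f‖²_{H_{√2σ}} ≤ ‖g‖²_{H_σ}` for `f = ∑ w_a k_{√2σ}(·, η_a)` and `g = ∑ w_a k_σ(·, η_a)`. -/
theorem stmt_0 (d : ℕ) (hd : 1 ≤ d) (σ : ℝ) (hσ : 0 < σ) (M : ℕ)
    (η : Fin M → EuclideanSpace ℝ (Fin d)) (w : Fin M → ℝ) :
    ∑ a : Fin M, ∑ b : Fin M, w a * w b * gaussKernel d (Real.sqrt 2 * σ) (η a) (η b) ≤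
      ∑ a : Fin M, ∑ b : Fin M, w a * w b * gaussKernel d σ (η a) (η b) := by
  refine sum_sum_gaussKernel_le hσ (le_mul_of_one_le_left hσ.le ?_) η w
  exact Real.one_le_sqrt.mpr one_le_two
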